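/- The graph Y(2e,K) is a divisible design graph with parameters (v,k,λ1,λ2,m,n) where v = q^{2e-1}(q^{2e}-1)/(q-1), k = q^{4e-3}-q^{2e-2}, λ1 = q^{4e-3}-q^{4e-4}-q^{2e-2}, λ2 = q^{4e-4}-q^{4e-5}-q^{2e-2}+q^{2e-3}, m = (q^{2e}-1)/(q-1), n = q^{2e-1}. That is: Y(2e,K) has exactly v vertices, every vertex has degree exactly k, and there is a partition of the vertex set into m classes each of cardinality n such that any two distinct vertices from the same class have exactly λ1 common neighbours and any two vertices from different classes have exactly λ2 common neighbours. -/

import Mathlib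

open Matrix

/-- The symplectic form `a M bᵀ` where `M = [[0, Iₑ],[-Iₑ, 0]]`. -/
def sympForm (K : Type) [CommRing K] (e : ℕ) (a b : Fin e ⊕ Fin e → K) : K :=
  a ⬝ᵥ ((Matrix.fromBlocks (0 : Matrix (Fin e) (Fin e) K) 1 (-1) 0) *ᵥ b)

/-- `V'`: the set of 2e-tuples over `K` having at least one unit entry. -/
def unitTuples (K : Type) [CommRing K] (e : ℕ) : Set (Fin e ⊕ Fin e → K) :=
  {a | ∃ i, IsUnit (a i)}

/-- The equivalence class `[a]` of a tuple under unit scaling. -/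
def cls (K : Type) [CommRing K] (e : ℕ) (a : Fin e ⊕ Fin e → K) :
    Set (Fin e ⊕ Fin e → K) :=
  {b | ∃ σ : Kˣ, b = σ • a}

/-- `V`: the set of equivalence classes of elements of `V'` under unit scaling. -/
def classes (K : Type) [CommRing K] (e : ℕ) : Set (Set (Fin e ⊕ Fin e → K)) :=
  {S | ∃ a ∈ unitTuples K e, S = cls K e a}

/-- Adjacency in the graph `X(2e,K)`: `a M bᵀ ∈ K \ {0}`. -/
def adjX (K : Type) [CommRing K] (e : ℕ) (A B : Set (Fin e ⊕ Fin e → K)) : Prop :=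
  ∃ a ∈ A, ∃ b ∈ B, sympForm K e a b ≠ 0

/-- Adjacency in the complement of `X(2e,K)`: distinct classes with `a M bᵀ = 0`. -/
def adjXc (K : Type) [CommRing K] (e : ℕ) (A B : Set (Fin e ⊕ Fin e → K)) : Prop :=
  A ≠ B ∧ ∃ a ∈ A, ∃ b ∈ B, sympForm K e a b = 0

/-- Adjacency in the graph `Y(2e,K)`: `a M bᵀ ∈ J \ {0}`. -/
def adjY (K : Type) [CommRing K] (J : Ideal K) (e : ℕ)
    (A B : Set (Fin e ⊕ Fin e → K)) : Prop :=
  ∃ a ∈ A, ∃ b ∈ B, sympForm K e a b ∈ J ∧ sympForm K e a b ≠ 0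

/-- `T = J × ⋯ × J` (2e factors), as a subset of `K^{2e}`. -/
def Tset (K : Type) [CommRing K] (J : Ideal K) (e : ℕ) : Set (Fin e ⊕ Fin e → K) :=
  {x | ∀ i, x i ∈ J}

/-- A hyperplane of `T`: a `K`-submodule contained in `T` of cardinality `q^(2e-1)`. -/
def IsHyperplane (K : Type) [CommRing K] (J : Ideal K) (e q : ℕ)
    (H : Submodule K (Fin e ⊕ Fin e → K)) : Prop :=
  (H : Set (Fin e ⊕ Fin e → K)) ⊆ Tset K J e ∧ Nat.card H = q ^ (2 * e - 1)

/-- `C(H,u) = {[u+h] : h ∈ H}`. -/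
def classSet (K : Type) [CommRing K] (e : ℕ) (H : Submodule K (Fin e ⊕ Fin e → K))
    (u : Fin e ⊕ Fin e → K) : Set (Set (Fin e ⊕ Fin e → K)) :=
  {S | ∃ h ∈ (H : Set (Fin e ⊕ Fin e → K)), S = cls K e (u + h)}

/-- The set of tuples `{σ • (u+h) : σ ∈ Kˣ, h ∈ H}`. -/
def orbitSet (K : Type) [CommRing K] (e : ℕ) (H : Submodule K (Fin e ⊕ Fin e → K))
    (u : Fin e ⊕ Fin e → K) : Set (Fin e ⊕ Fin e → K) :=
  {x | ∃ σ : Kˣ, ∃ h ∈ (H : Set (Fin e ⊕ Fin e → K)), x = σ • (u + h)}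

/-- The coset `c • u + T` of `T`. -/
def cosetOf (K : Type) [CommRing K] (J : Ideal K) (e : ℕ) (c : K)
    (u : Fin e ⊕ Fin e → K) : Set (Fin e ⊕ Fin e → K) :=
  {x | ∃ t ∈ Tset K J e, x = c • u + t}

section ChainRing

variable {K : Type} [CommRing K] {J : Ideal K} {r : K}

lemma mem_iff_not_isUnit (hJtop : J ≠ ⊤) (hideals : ∀ I : Ideal K, I = ⊥ ∨ I = J ∨ I = ⊤)
    (x : K) : x ∈ J ↔ ¬ IsUnit x := by
  refine ⟨fun hx hu => hJtop (Ideal.eq_top_of_isUnit_mem J hx hu), fun hx => ?_⟩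
  have hmem := Ideal.mem_span_singleton_self x
  rcases hideals (Ideal.span {x}) with h | h | h
  · rw [h, Ideal.mem_bot] at hmem
    simp [hmem]
  · rwa [h] at hmem
  · exact absurd (Ideal.span_singleton_eq_top.mp h) hx

lemma generator_mul_self (hJr : J = Ideal.span {r}) (hJtop : J ≠ ⊤)
    (hideals : ∀ I : Ideal K, I = ⊥ ∨ I = J ∨ I = ⊤) : r * r = 0 := by
  have hr : r ∈ J := hJr ▸ Ideal.mem_span_singleton_self r
  rcases hideals (Ideal.span {r * r}) with h | h | h
  · exact Ideal.span_singleton_eq_bot.mp h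
  · rw [← h, Ideal.mem_span_singleton'] at hr
    obtain ⟨s, hs⟩ := hr
    have hr' : r ∈ J := hJr ▸ Ideal.mem_span_singleton_self r
    have hu : IsUnit (1 - s * r) := by
      by_contra hu
      have h1 := (mem_iff_not_isUnit hJtop hideals _).mpr hu
      have h2 := J.add_mem h1 (J.mul_mem_left s hr')
      rw [sub_add_cancel] at h2
      exact hJtop ((Ideal.eq_top_iff_one J).mpr h2)
    have h0 : (1 - s * r) * r = 0 := by linear_combination -hs
    have := (hu.mul_right_eq_zero).mp h0
    simp [this]
  · exact absurd (Ideal.span_singleton_eq_top.mp h)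
      ((mem_iff_not_isUnit hJtop hideals _).mp (J.mul_mem_left r hr))

lemma mul_generator_eq_zero_iff (hJr : J = Ideal.span {r}) (hJbot : J ≠ ⊥)
    (hunit : ∀ x, x ∈ J ↔ ¬ IsUnit x) (hrr : r * r = 0) (x : K) : x * r = 0 ↔ x ∈ J := by
  constructor
  · intro hx
    rw [hunit]
    intro hu
    refine hJbot ?_
    rw [hJr, Ideal.span_singleton_eq_bot]
    exact (hu.mul_right_eq_zero).mp hx
  · intro hx
    rw [hJr, Ideal.mem_span_singleton'] at hx
    obtain ⟨s, rfl⟩ := hx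
    rw [mul_assoc, hrr, mul_zero]

lemma card_ideal_eq_card_quotient (hJr : J = Ideal.span {r})
    (hmul : ∀ x, x * r = 0 ↔ x ∈ J) : Nat.card J = Nat.card (K ⧸ J) := by
  have htors : Ideal.torsionOf K K r = J := by
    ext x
    simp [Ideal.mem_torsionOf_iff, hmul]
  have := Nat.card_congr (Ideal.quotTorsionOfEquivSpanSingleton K K r).toEquiv
  rw [htors] at this
  rw [this, hJr]

lemma card_units_add_card_ideal [Finite K] (hunit : ∀ x, x ∈ J ↔ ¬ IsUnit x) :
    Nat.card Kˣ + Nat.card J = Nat.card K := by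
  have h1 : Nat.card Kˣ = {x : K | IsUnit x}.ncard := by
    refine Nat.card_congr (Equiv.ofBijective (fun u : Kˣ => ⟨(u : K), u.isUnit⟩) ⟨?_, ?_⟩)
    · intro u v h
      exact Units.ext (congrArg Subtype.val h)
    · rintro ⟨x, u, rfl⟩
      exact ⟨u, rfl⟩
  have h2 : (J : Set K) = {x : K | IsUnit x}ᶜ := by
    ext x
    exact hunit x
  have h3 : Nat.card J = (J : Set K).ncard := rfl
  rw [h1, h3, h2, Set.ncard_add_ncard_compl]

lemma ncard_ideal_ne_zero [Finite K] : {x : K | x ∈ J ∧ x ≠ 0}.ncard + 1 = Nat.card J := by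
  have h : {x : K | x ∈ J ∧ x ≠ 0} = (J : Set K) \ {0} := by
    ext x
    simp
  rw [h, Set.ncard_sdiff_singleton_add_one J.zero_mem]
  rfl

end ChainRing

section LinearCount

variable {K : Type} [CommRing K]

lemma ncard_sep_map_mul {V W : Type} [AddCommGroup V] [AddCommGroup W] [Module K V] [Module K W]
    (L : V →ₗ[K] W) {S : Submodule K V} {S' : Submodule K W}
    (hmap : S.map L = S') (p : W → Prop) :
    {v | v ∈ S ∧ p (L v)}.ncard * Nat.card S' = {w | w ∈ S' ∧ p w}.ncard * Nat.card S := by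
  have hsec : ∀ w : S', ∃ v ∈ S, L v = w := fun w =>
    Submodule.mem_map.mp (hmap.ge w.2)
  choose s hsS hs using hsec
  have key : ∀ p : W → Prop, {v | v ∈ S ∧ p (L v)}.ncard =
      {w | w ∈ S' ∧ p w}.ncard * {v | v ∈ S ∧ L v = 0}.ncard := by
    intro p
    have hL : ∀ v ∈ S, L v ∈ S' := fun v hv => hmap ▸ Submodule.mem_map_of_mem hv
    have e : {v | v ∈ S ∧ p (L v)} ≃ {w | w ∈ S' ∧ p w} × {v | v ∈ S ∧ L v = 0} :=
      { toFun := fun v => (⟨L v, hL _ v.2.1, v.2.2⟩,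
          ⟨v - s ⟨L v, hL _ v.2.1⟩, S.sub_mem v.2.1 (hsS _), by rw [map_sub, hs, sub_self]⟩)
        invFun := fun x => ⟨s ⟨x.1, x.1.2.1⟩ + x.2, S.add_mem (hsS _) x.2.2.1, by
          rw [map_add, hs, x.2.2.2, add_zero]
          exact x.1.2.2⟩
        left_inv := fun v => by simp
        right_inv := fun x => by
          have h : L (s ⟨x.1, x.1.2.1⟩ + x.2) = x.1 := by rw [map_add, hs, x.2.2.2, add_zero]
          ext <;> simp [h] }
    have := Nat.card_congr e
    rwa [Nat.card_prod] at this
  have htot := key (fun _ => True)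
  simp only [and_true] at htot
  have h1 : {v | v ∈ S}.ncard = Nat.card S := rfl
  have h2 : {w | w ∈ S'}.ncard = Nat.card S' := rfl
  rw [h1, h2] at htot
  rw [key p, htot]
  ring

variable {ι : Type} [Fintype ι]

lemma card_pi_ideal (I : Ideal K) :
    Nat.card (Submodule.pi Set.univ (fun _ : ι => I)) = Nat.card I ^ Fintype.card ι := by
  have e : (Submodule.pi Set.univ (fun _ : ι => I)) ≃ (ι → I) :=
    { toFun := fun d i => ⟨d.1 i, d.2 i trivial⟩
      invFun := fun d => ⟨fun i => d i, fun i _ => (d i).2⟩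
      left_inv := fun _ => rfl
      right_inv := fun _ => rfl }
  rw [Nat.card_congr e, Nat.card_fun, Nat.card_eq_fintype_card (α := ι)]

lemma dotProduct_mem_ideal (I : Ideal K) (a : ι → K) {d : ι → K} (hd : ∀ i, d i ∈ I) :
    a ⬝ᵥ d ∈ I :=
  I.sum_mem fun i _ => I.mul_mem_left _ (hd i)

lemma ncard_sep_dotProduct_mul (I : Ideal K) {a : ι → K} (ha : ∃ i, IsUnit (a i))
    (p : K → Prop) :
    {d : ι → K | (∀ i, d i ∈ I) ∧ p (a ⬝ᵥ d)}.ncard * Nat.card I =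
      {x | x ∈ I ∧ p x}.ncard * Nat.card I ^ Fintype.card ι := by
  classical
  obtain ⟨i, u, hu⟩ := ha
  have hmap : (Submodule.pi Set.univ (fun _ : ι => I)).map (dotProductBilin K K a) = I := by
    ext x
    simp only [Submodule.mem_map, Submodule.mem_pi, Set.mem_univ, true_imp_iff]
    constructor
    · rintro ⟨d, hd, rfl⟩
      exact dotProduct_mem_ideal I a hd
    · intro hx
      refine ⟨Pi.single i (↑u⁻¹ * x), fun j => ?_, ?_⟩
      · rcases eq_or_ne j i with rfl | h
        · simpa using hx
        · simp [h]
      · simp [← hu]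
  have := ncard_sep_map_mul _ hmap p
  rw [card_pi_ideal] at this
  simpa [Submodule.mem_pi] using this

lemma ncard_sep_dotProduct_dotProduct_mul (I : Ideal K) {a b : ι → K}
    (hab : ∃ i j, IsUnit (a i * b j - a j * b i)) (p : K → K → Prop) :
    {d : ι → K | (∀ i, d i ∈ I) ∧ p (a ⬝ᵥ d) (b ⬝ᵥ d)}.ncard * Nat.card I ^ 2 =
      {x : K × K | (x.1 ∈ I ∧ x.2 ∈ I) ∧ p x.1 x.2}.ncard * Nat.card I ^ Fintype.card ι := by
  classical
  obtain ⟨i, j, u, hu⟩ := hab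
  have hmap : (Submodule.pi Set.univ (fun _ : ι => I)).map
      ((dotProductBilin K K a).prod (dotProductBilin K K b)) = Submodule.prod I I := by
    ext ⟨x, y⟩
    simp only [Submodule.mem_map, Submodule.mem_pi, Set.mem_univ, true_imp_iff,
      Submodule.mem_prod]
    constructor
    · rintro ⟨d, hd, h⟩
      rw [← (Prod.mk.inj h).1, ← (Prod.mk.inj h).2]
      exact ⟨dotProduct_mem_ideal I a hd, dotProduct_mem_ideal I b hd⟩
    · rintro ⟨hx, hy⟩
      have huu : (↑u⁻¹ : K) * (a i * b j - a j * b i) = 1 := by rw [← hu, Units.inv_mul]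
      refine ⟨Pi.single i (↑u⁻¹ * (b j * x - a j * y)) + Pi.single j (↑u⁻¹ * (a i * y - b i * x)),
        fun k => ?_, ?_⟩
      · refine I.add_mem ?_ ?_
        · rw [Pi.single_apply]
          split_ifs
          · exact I.mul_mem_left _ (I.sub_mem (I.mul_mem_left _ hx) (I.mul_mem_left _ hy))
          · exact I.zero_mem
        · rw [Pi.single_apply]
          split_ifs
          · exact I.mul_mem_left _ (I.sub_mem (I.mul_mem_left _ hy) (I.mul_mem_left _ hx))
          · exact I.zero_mem
      · refine Prod.ext ?_ ?_
        · simp only [LinearMap.prod_apply, Function.prod_apply, dotProductBilin_apply_apply,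
            dotProduct_add, dotProduct_single]
          linear_combination x * huu
        · simp only [LinearMap.prod_apply, Function.prod_apply, dotProductBilin_apply_apply,
            dotProduct_add, dotProduct_single]
          linear_combination y * huu
  have hcard : Nat.card (Submodule.prod I I) = Nat.card I ^ 2 := by
    have h : ((Submodule.prod I I : Submodule K (K × K)) : Set (K × K)).ncard =
        (I : Set K).ncard * (I : Set K).ncard := by
      rw [Submodule.prod_coe, Set.ncard_prod]
    rw [sq]
    exact h
  have := ncard_sep_map_mul _ hmap (fun x => p x.1 x.2)
  rw [card_pi_ideal, hcard] at this
  simpa [Submodule.mem_pi] using this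

end LinearCount

section TupleCount

lemma card_top_ideal {K : Type} [CommRing K] : Nat.card (⊤ : Ideal K) = Nat.card K :=
  Nat.card_congr Submodule.topEquiv.toEquiv

lemma exists_isUnit_minor {K ι : Type} [CommRing K] {J : Ideal K} (hunit : ∀ x, x ∈ J ↔ ¬ IsUnit x)
    {a t : ι → K}
    (ha : ∃ i, IsUnit (a i)) (h : ¬ ∃ c, ∀ j, t j - c * a j ∈ J) :
    ∃ i j, IsUnit (a i * t j - a j * t i) := by
  by_contra! hcon
  obtain ⟨i, u, hu⟩ := ha
  refine h ⟨↑u⁻¹ * t i, fun j => ?_⟩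
  have hj := J.mul_mem_left (↑u⁻¹ : K) ((hunit _).mpr (hcon i j))
  rw [← hu] at hj
  have : (↑u⁻¹ : K) * (u * t j - a j * t i) = t j - ↑u⁻¹ * t i * a j := by
    linear_combination t j * u.inv_mul
  rwa [this] at hj

variable {K : Type} [CommRing K] [Finite K] {J : Ideal K} {q s : ℕ} {ι : Type} [Fintype ι]

lemma ncard_unit_sep_add (hunit : ∀ x, x ∈ J ↔ ¬ IsUnit x) (p : (ι → K) → Prop) :
    {d : ι → K | (∃ i, IsUnit (d i)) ∧ p d}.ncard + {d : ι → K | (∀ i, d i ∈ J) ∧ p d}.ncard =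
      {d : ι → K | (∀ i, d i ∈ (⊤ : Ideal K)) ∧ p d}.ncard := by
  rw [← Set.ncard_union_eq]
  · congr 1
    ext d
    have h : (∀ i, d i ∈ J) ↔ ¬ ∃ i, IsUnit (d i) := by simp [hunit]
    simp only [Set.mem_union, Set.mem_ofPred_eq, Submodule.mem_top, implies_true, true_and, h]
    tauto
  · rw [Set.disjoint_left]
    rintro d ⟨⟨i, hi⟩, -⟩ ⟨h, -⟩
    exact (hunit _).mp (h i) hi

lemma ncard_unitTuples_add (hunit : ∀ x, x ∈ J ↔ ¬ IsUnit x) (hJ : Nat.card J = q)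
    (hK : Nat.card K = q ^ 2) :
    {d : ι → K | ∃ i, IsUnit (d i)}.ncard + q ^ Fintype.card ι = q ^ (2 * Fintype.card ι) := by
  have h := ncard_unit_sep_add (ι := ι) hunit (fun _ => True)
  have h1 : ∀ I : Ideal K, {d : ι → K | ∀ i, d i ∈ I}.ncard =
      Nat.card I ^ Fintype.card ι := fun I => by
    rw [← card_pi_ideal]
    exact congrArg Set.ncard (by ext d; simp)
  simp only [and_true, h1, hJ, card_top_ideal, hK] at h
  rw [h, pow_mul]

lemma ncard_unit_sep_dotProduct (hunit : ∀ x, x ∈ J ↔ ¬ IsUnit x) (hs : q = s + 1)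
    (hJ : Nat.card J = q) (hK : Nat.card K = q ^ 2) {M : ℕ} (hM : Fintype.card ι = M + 4)
    {a : ι → K} (ha : ∃ i, IsUnit (a i)) :
    {d : ι → K | (∃ i, IsUnit (d i)) ∧ a ⬝ᵥ d ∈ J ∧ a ⬝ᵥ d ≠ 0}.ncard + q ^ (M + 2) * (q * s) =
      q ^ (2 * M + 5) * (q * s) := by
  have hJ0 : {x : K | x ∈ J ∧ x ≠ 0}.ncard = s := by
    have := ncard_ideal_ne_zero (J := J)
    omega
  have h := ncard_unit_sep_add hunit (fun d : ι → K => a ⬝ᵥ d ∈ J ∧ a ⬝ᵥ d ≠ 0)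
  have h1 := ncard_sep_dotProduct_mul J ha (fun x => x ∈ J ∧ x ≠ 0)
  have h2 := ncard_sep_dotProduct_mul ⊤ ha (fun x => x ∈ J ∧ x ≠ 0)
  rw [card_top_ideal, hK] at h2
  simp only [Submodule.mem_top, true_and, implies_true, hM, hJ, hJ0, ← and_assoc,
    and_self] at h h1 h2 ⊢
  have hq : 0 < q := by omega
  have h1' := Nat.eq_of_mul_eq_mul_right hq (h1.trans
    (show s * q ^ (M + 4) = (q ^ (M + 2) * (q * s)) * q by ring))
  have h2' := Nat.eq_of_mul_eq_mul_right (pow_pos hq 2) (h2.trans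
    (show s * (q ^ 2) ^ (M + 4) = (q ^ (2 * M + 5) * (q * s)) * q ^ 2 by ring))
  rw [← h1', ← h2']
  exact h

lemma ncard_ne_zero_add_mul_ne_zero {r : K}
    (hr : r ∈ J) (hmul : ∀ x, x * r = 0 ↔ x ∈ J) (hs : q = s + 1)
    (hJ : Nat.card J = q) (hK : Nat.card K = q ^ 2) :
    {x : K × K | (x.1 ∈ J ∧ x.1 ≠ 0) ∧ x.1 + r * x.2 ∈ J ∧ x.1 + r * x.2 ≠ 0}.ncard =
      s * (q * s) := by
  have hJ0 : {x : K | x ∈ J ∧ x ≠ 0}.ncard = s := by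
    have := ncard_ideal_ne_zero (J := J)
    omega
  have hU : {x : K | x ∉ J}.ncard + q = q ^ 2 := by
    rw [← hK, ← hJ, ← Set.ncard_add_ncard_compl (J : Set K), add_comm]
    rfl
  have hall : {x : K × K | x.1 ∈ J ∧ x.1 ≠ 0}.ncard = s * q ^ 2 := by
    have : {x : K × K | x.1 ∈ J ∧ x.1 ≠ 0} = {x : K | x ∈ J ∧ x ≠ 0} ×ˢ Set.univ := by
      ext x
      simp
    rw [this, Set.ncard_prod, Set.ncard_univ, hJ0, hK]
  have hbad : ((fun y : K => (-(r * y), y)) '' {x : K | x ∉ J}).ncard = {x : K | x ∉ J}.ncard :=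
    Set.ncard_image_of_injective _ fun y z h => (Prod.mk.inj h).2
  have hdiff : {x : K × K | (x.1 ∈ J ∧ x.1 ≠ 0) ∧ x.1 + r * x.2 ∈ J ∧ x.1 + r * x.2 ≠ 0} =
      {x : K × K | x.1 ∈ J ∧ x.1 ≠ 0} \ ((fun y : K => (-(r * y), y)) '' {x : K | x ∉ J}) := by
    ext ⟨x, y⟩
    simp only [Set.mem_ofPred_eq, Set.mem_sdiff, Set.mem_image, Prod.mk.injEq]
    constructor
    · rintro ⟨hx, -, hne⟩
      refine ⟨hx, ?_⟩
      rintro ⟨z, -, rfl, rfl⟩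
      exact hne (by ring)
    · rintro ⟨hx, hne⟩
      refine ⟨hx, J.add_mem hx.1 (J.mul_mem_right _ hr), fun h0 => ?_⟩
      refine hne ⟨y, fun hy => hx.2 ?_, by linear_combination -h0, rfl⟩
      rw [← hmul] at hy
      linear_combination h0 - hy
  have hsub : ((fun y : K => (-(r * y), y)) '' {x : K | x ∉ J}) ⊆
      {x : K × K | x.1 ∈ J ∧ x.1 ≠ 0} := by
    rintro _ ⟨y, hy, rfl⟩
    refine ⟨J.neg_mem (J.mul_mem_right _ hr), fun h0 => hy ?_⟩
    rw [← hmul]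
    linear_combination -h0
  have h := Set.ncard_sdiff_add_ncard_of_subset hsub
  rw [← hdiff, hbad, hall] at h
  subst hs
  have : {x : K | x ∉ J}.ncard = (s + 1) * s := by nlinarith
  rw [this] at h
  nlinarith

lemma ncard_unit_sep_dotProduct_add_smul {r : K} (hunit : ∀ x, x ∈ J ↔ ¬ IsUnit x)
    (hr : r ∈ J) (hmul : ∀ x, x * r = 0 ↔ x ∈ J) (hs : q = s + 1)
    (hJ : Nat.card J = q) (hK : Nat.card K = q ^ 2) {M : ℕ} (hM : Fintype.card ι = M + 4)
    {a t : ι → K} (hat : ∃ i j, IsUnit (a i * t j - a j * t i)) (ha : ∃ i, IsUnit (a i)) :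
    {d : ι → K | (∃ i, IsUnit (d i)) ∧ (a ⬝ᵥ d ∈ J ∧ a ⬝ᵥ d ≠ 0) ∧
        (a + r • t) ⬝ᵥ d ∈ J ∧ (a + r • t) ⬝ᵥ d ≠ 0}.ncard + q ^ (M + 2) * (q * s) =
      s * q ^ (2 * M + 4) * (q * s) := by
  have hJ0 : {x : K | x ∈ J ∧ x ≠ 0}.ncard = s := by
    have := ncard_ideal_ne_zero (J := J)
    omega
  have h := ncard_unit_sep_add hunit (fun d : ι → K => (a ⬝ᵥ d ∈ J ∧ a ⬝ᵥ d ≠ 0) ∧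
        (a + r • t) ⬝ᵥ d ∈ J ∧ (a + r • t) ⬝ᵥ d ≠ 0)
  have h1 := ncard_sep_dotProduct_mul J ha (fun x => x ∈ J ∧ x ≠ 0)
  have h2 := ncard_sep_dotProduct_dotProduct_mul ⊤ hat
    (fun x y => (x ∈ J ∧ x ≠ 0) ∧ x + r * y ∈ J ∧ x + r * y ≠ 0)
  rw [card_top_ideal, hK] at h2
  have hbad : {d : ι → K | (∀ i, d i ∈ J) ∧ (a ⬝ᵥ d ∈ J ∧ a ⬝ᵥ d ≠ 0) ∧
        (a + r • t) ⬝ᵥ d ∈ J ∧ (a + r • t) ⬝ᵥ d ≠ 0} =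
      {d : ι → K | (∀ i, d i ∈ J) ∧ a ⬝ᵥ d ∈ J ∧ a ⬝ᵥ d ≠ 0} := by
    ext d
    simp only [Set.mem_ofPred_eq, and_congr_right_iff, and_iff_left_iff_imp]
    intro hd h
    have h0 : (a + r • t) ⬝ᵥ d = a ⬝ᵥ d := by
      rw [add_dotProduct, smul_dotProduct, smul_eq_mul, mul_comm,
        (hmul _).mpr (dotProduct_mem_ideal J t hd), add_zero]
    rwa [h0]
  rw [hbad] at h
  simp only [add_dotProduct, smul_dotProduct, smul_eq_mul] at h ⊢
  simp only [Submodule.mem_top, true_and, implies_true, and_self, hM, hJ] at h h1 h2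
  rw [ncard_ne_zero_add_mul_ne_zero hr hmul hs hJ hK] at h2
  simp only [← and_assoc, and_self, hJ0] at h1
  simp only [← and_assoc] at h h2 ⊢
  have hq : 0 < q := by omega
  have h1' := Nat.eq_of_mul_eq_mul_right hq (h1.trans
    (show s * q ^ (M + 4) = (q ^ (M + 2) * (q * s)) * q by ring))
  have h2' := Nat.eq_of_mul_eq_mul_right (pow_pos (pow_pos hq 2) 2) (h2.trans
    (show s * (q * s) * (q ^ 2) ^ (M + 4) = (s * q ^ (2 * M + 4) * (q * s)) * (q ^ 2) ^ 2 by ring))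
  rw [← h1', ← h2']
  exact h

lemma ncard_unit_sep_dotProduct_dotProduct (hunit : ∀ x, x ∈ J ↔ ¬ IsUnit x) (hs : q = s + 1)
    (hJ : Nat.card J = q) (hK : Nat.card K = q ^ 2) {M : ℕ} (hM : Fintype.card ι = M + 4)
    {a b : ι → K} (hab : ∃ i j, IsUnit (a i * b j - a j * b i)) :
    {d : ι → K | (∃ i, IsUnit (d i)) ∧ (a ⬝ᵥ d ∈ J ∧ a ⬝ᵥ d ≠ 0) ∧
        b ⬝ᵥ d ∈ J ∧ b ⬝ᵥ d ≠ 0}.ncard + s * q ^ (M + 1) * (q * s) =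
      s * q ^ (2 * M + 3) * (q * s) := by
  have hJ0 : {x : K | x ∈ J ∧ x ≠ 0}.ncard = s := by
    have := ncard_ideal_ne_zero (J := J)
    omega
  have hpair : {x : K × K | (x.1 ∈ J ∧ x.1 ≠ 0) ∧ x.2 ∈ J ∧ x.2 ≠ 0}.ncard = s * s := by
    have := Set.ncard_prod (s := {x : K | x ∈ J ∧ x ≠ 0}) (t := {x : K | x ∈ J ∧ x ≠ 0})
    rw [hJ0] at this
    exact this
  have hpair' : {x : K × K | (x.1 ∈ J ∧ x.2 ∈ J) ∧ (x.1 ∈ J ∧ x.1 ≠ 0) ∧ x.2 ∈ J ∧ x.2 ≠ 0} =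
      {x : K × K | (x.1 ∈ J ∧ x.1 ≠ 0) ∧ x.2 ∈ J ∧ x.2 ≠ 0} := by
    ext x
    simp only [Set.mem_ofPred_eq]
    tauto
  have h := ncard_unit_sep_add hunit (fun d : ι → K => (a ⬝ᵥ d ∈ J ∧ a ⬝ᵥ d ≠ 0) ∧
        b ⬝ᵥ d ∈ J ∧ b ⬝ᵥ d ≠ 0)
  have h1 := ncard_sep_dotProduct_dotProduct_mul J hab
    (fun x y => (x ∈ J ∧ x ≠ 0) ∧ y ∈ J ∧ y ≠ 0)
  have h2 := ncard_sep_dotProduct_dotProduct_mul ⊤ hab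
    (fun x y => (x ∈ J ∧ x ≠ 0) ∧ y ∈ J ∧ y ≠ 0)
  rw [card_top_ideal, hK] at h2
  rw [hpair', hpair, hJ, hM] at h1
  simp only [Submodule.mem_top, true_and, implies_true, and_self, hM, hpair] at h h2
  have hq : 0 < q := by omega
  have h1' := Nat.eq_of_mul_eq_mul_right (pow_pos hq 2) (h1.trans
    (show s * s * q ^ (M + 4) = (s * q ^ (M + 1) * (q * s)) * q ^ 2 by ring))
  have h2' := Nat.eq_of_mul_eq_mul_right (pow_pos (pow_pos hq 2) 2) (h2.trans
    (show s * s * (q ^ 2) ^ (M + 4) = (s * q ^ (2 * M + 3) * (q * s)) * (q ^ 2) ^ 2 by ring))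
  rw [← h1', ← h2']
  exact h

end TupleCount

section ProjectiveClasses

variable {K : Type} [CommRing K] {J : Ideal K} {q s e : ℕ}

/-- Multiplication of a tuple by the matrix `M` of the symplectic form. -/
def sympTwist (K : Type) [CommRing K] (e : ℕ) :
    (Fin e ⊕ Fin e → K) ≃ (Fin e ⊕ Fin e → K) where
  toFun c := Sum.elim (c ∘ Sum.inr) (-(c ∘ Sum.inl))
  invFun d := Sum.elim (-(d ∘ Sum.inr)) (d ∘ Sum.inl)
  left_inv c := by
    ext i
    cases i <;> simp
  right_inv d := by
    ext i
    cases i <;> simp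

lemma sympForm_eq_dotProduct (a c : Fin e ⊕ Fin e → K) :
    sympForm K e a c = a ⬝ᵥ sympTwist K e c := by
  simp [sympForm, sympTwist, Matrix.fromBlocks_mulVec, Matrix.neg_mulVec]

lemma sympForm_swap (a c : Fin e ⊕ Fin e → K) : sympForm K e c a = -sympForm K e a c := by
  simp only [sympForm_eq_dotProduct, sympTwist, Equiv.coe_fn_mk, dotProduct, Fintype.sum_sum_type,
    Sum.elim_inl, Sum.elim_inr, Function.comp_apply, Pi.neg_apply, neg_add, ← Finset.sum_neg_distrib]
  rw [add_comm]
  congr 1 <;> exact Finset.sum_congr rfl fun i _ => by ring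

lemma sympForm_smul_smul (σ τ : Kˣ) (a c : Fin e ⊕ Fin e → K) :
    sympForm K e (σ • a) (τ • c) = ↑(σ * τ) * sympForm K e a c := by
  simp only [sympForm, Matrix.mulVec_smul, smul_dotProduct, dotProduct_smul, Units.smul_def,
    smul_eq_mul, Units.val_mul]
  ring

lemma isUnit_twist_iff (c : Fin e ⊕ Fin e → K) :
    (∃ i, IsUnit (sympTwist K e c i)) ↔ c ∈ unitTuples K e := by
  simp [unitTuples, sympTwist, or_comm]

lemma ncard_unitTuples_sep_twist (p : (Fin e ⊕ Fin e → K) → Prop) :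
    {c | c ∈ unitTuples K e ∧ p (sympTwist K e c)}.ncard =
      {d : Fin e ⊕ Fin e → K | (∃ i, IsUnit (d i)) ∧ p d}.ncard :=
  Nat.card_congr ((sympTwist K e).subtypeEquiv fun c => and_congr_left' (isUnit_twist_iff c).symm)

lemma self_mem_cls (a : Fin e ⊕ Fin e → K) : a ∈ cls K e a := ⟨1, (one_smul _ a).symm⟩

lemma cls_smul (σ : Kˣ) (a : Fin e ⊕ Fin e → K) : cls K e (σ • a) = cls K e a := by
  ext b
  constructor
  · rintro ⟨τ, rfl⟩
    exact ⟨τ * σ, (mul_smul _ _ _).symm⟩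
  · rintro ⟨τ, rfl⟩
    exact ⟨τ * σ⁻¹, by rw [mul_smul, inv_smul_smul]⟩

lemma cls_eq_cls_iff {a b : Fin e ⊕ Fin e → K} :
    cls K e a = cls K e b ↔ ∃ σ : Kˣ, b = σ • a := by
  constructor
  · intro h
    have := self_mem_cls b
    rwa [← h] at this
  · rintro ⟨σ, rfl⟩
    exact (cls_smul σ a).symm

lemma smul_mem_unitTuples (σ : Kˣ) {a : Fin e ⊕ Fin e → K} (ha : a ∈ unitTuples K e) :
    σ • a ∈ unitTuples K e :=
  ha.imp fun i hi => by
    rw [Pi.smul_apply, Units.smul_def, smul_eq_mul]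
    exact σ.isUnit.mul hi

lemma adjY_cls_iff (a c : Fin e ⊕ Fin e → K) :
    adjY K J e (cls K e a) (cls K e c) ↔ sympForm K e a c ∈ J ∧ sympForm K e a c ≠ 0 := by
  constructor
  · rintro ⟨_, ⟨σ, rfl⟩, _, ⟨τ, rfl⟩, hmem, hne⟩
    rw [sympForm_smul_smul] at hmem hne
    refine ⟨?_, right_ne_zero_of_mul hne⟩
    have := J.mul_mem_left (↑(σ * τ)⁻¹ : K) hmem
    rwa [Units.inv_mul_cancel_left] at this
  · intro h
    exact ⟨a, self_mem_cls a, c, self_mem_cls c, h⟩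

lemma adjY_cls_comm (a c : Fin e ⊕ Fin e → K) :
    adjY K J e (cls K e c) (cls K e a) ↔ adjY K J e (cls K e a) (cls K e c) := by
  rw [adjY_cls_iff, adjY_cls_iff, sympForm_swap, neg_mem_iff, neg_ne_zero]

lemma ncard_classes_sep_mul (p : Set (Fin e ⊕ Fin e → K) → Prop) :
    {C | C ∈ classes K e ∧ p C}.ncard * Nat.card Kˣ =
      {c | c ∈ unitTuples K e ∧ p (cls K e c)}.ncard := by
  have hrep : ∀ C : {C | C ∈ classes K e ∧ p C}, ∃ c ∈ unitTuples K e, C = cls K e c :=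
    fun C => C.2.1
  choose f hf hfC using hrep
  have e : {C | C ∈ classes K e ∧ p C} × Kˣ ≃ {c | c ∈ unitTuples K e ∧ p (cls K e c)} :=
    Equiv.ofBijective (fun x => ⟨x.2 • f x.1, smul_mem_unitTuples _ (hf _), by
      rw [cls_smul, ← hfC]; exact x.1.2.2⟩) <| by
      constructor
      · rintro ⟨C, σ⟩ ⟨D, τ⟩ h
        have h' : σ • f C = τ • f D := congrArg Subtype.val h
        have hCD : C = D := by
          apply Subtype.ext
          rw [hfC, hfC, ← cls_smul σ, h', cls_smul]
        subst hCD
        obtain ⟨i, hi⟩ := hf C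
        have hi' := congrFun h' i
        simp only [Pi.smul_apply, Units.smul_def, smul_eq_mul] at hi'
        rw [Units.ext (hi.mul_right_cancel hi')]
      · rintro ⟨c, hc, hp⟩
        have h := (hfC ⟨cls K e c, ⟨c, hc, rfl⟩, hp⟩).symm
        obtain ⟨σ, hσ⟩ := cls_eq_cls_iff.mp h
        exact ⟨(_, σ), Subtype.ext hσ.symm⟩
  have := Nat.card_congr e
  rwa [Nat.card_prod] at this

/-- Two tuples span the same line modulo `J`. -/
def SameLine (J : Ideal K) (a b : Fin e ⊕ Fin e → K) : Prop :=
  ∃ σ : Kˣ, ∀ i, b i - σ * a i ∈ J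

lemma sameLine_smul (J : Ideal K) (σ : Kˣ) (a : Fin e ⊕ Fin e → K) : SameLine J a (σ • a) :=
  ⟨σ, fun i => by simp [Units.smul_def]⟩

lemma SameLine.symm {a b : Fin e ⊕ Fin e → K} (h : SameLine J a b) : SameLine J b a := by
  obtain ⟨σ, h⟩ := h
  refine ⟨σ⁻¹, fun i => ?_⟩
  have := J.mul_mem_left (-(↑σ⁻¹ : K)) (h i)
  have h' : -(↑σ⁻¹ : K) * (b i - σ * a i) = a i - ↑σ⁻¹ * b i := by
    linear_combination a i * σ.inv_mul
  rwa [h'] at this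

lemma SameLine.trans {a b c : Fin e ⊕ Fin e → K} (h : SameLine J a b) (h' : SameLine J b c) :
    SameLine J a c := by
  obtain ⟨σ, h⟩ := h
  obtain ⟨τ, h'⟩ := h'
  refine ⟨τ * σ, fun i => ?_⟩
  have := J.add_mem (h' i) (J.mul_mem_left τ (h i))
  have hsum : c i - τ * b i + τ * (b i - σ * a i) = c i - ↑(τ * σ) * a i := by
    push_cast
    ring
  rwa [hsum] at this

/-- The classes of tuples spanning the same line as `a` modulo `J`. -/
def lineBlock (J : Ideal K) (a : Fin e ⊕ Fin e → K) : Set (Set (Fin e ⊕ Fin e → K)) :=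
  {B | ∃ b ∈ unitTuples K e, B = cls K e b ∧ SameLine J a b}

lemma cls_mem_lineBlock_iff {a b : Fin e ⊕ Fin e → K} (hb : b ∈ unitTuples K e) :
    cls K e b ∈ lineBlock J a ↔ SameLine J a b := by
  constructor
  · rintro ⟨c, -, hbc, h⟩
    obtain ⟨σ, rfl⟩ := cls_eq_cls_iff.mp hbc
    exact h.trans (sameLine_smul J σ b).symm
  · exact fun h => ⟨b, hb, rfl, h⟩

lemma lineBlock_eq {a b : Fin e ⊕ Fin e → K} (h : SameLine J a b) :
    lineBlock J a = lineBlock J b := by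
  ext C
  constructor
  · rintro ⟨c, hc, rfl, h'⟩
    exact ⟨c, hc, rfl, h.symm.trans h'⟩
  · rintro ⟨c, hc, rfl, h'⟩
    exact ⟨c, hc, rfl, h.trans h'⟩

lemma isUnit_of_sub_mem (hunit : ∀ x, x ∈ J ↔ ¬ IsUnit x) {x y : K} (hx : IsUnit x)
    (hxy : y - x ∈ J) : IsUnit y := by
  by_contra hy
  have := J.sub_mem ((hunit _).mpr hy) hxy
  rw [sub_sub_cancel] at this
  exact (hunit _).mp this hx

lemma ncard_lineBlock [Finite K] (hunit : ∀ x, x ∈ J ↔ ¬ IsUnit x)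
    (hJ : Nat.card J = q) {a : Fin e ⊕ Fin e → K} (ha : a ∈ unitTuples K e) :
    (lineBlock J a).ncard * q = q ^ (2 * e) := by
  classical
  obtain ⟨i, hi⟩ := ha
  have hS := ncard_sep_dotProduct_mul J (a := (Pi.single i 1 : Fin e ⊕ Fin e → K))
    ⟨i, by simp⟩ (fun x => x = 0)
  have hone : {x : K | x ∈ J ∧ x = 0}.ncard = 1 := by
    rw [Set.ncard_eq_one]
    refine ⟨0, ?_⟩
    ext x
    simp only [Set.mem_ofPred_eq, Set.mem_singleton_iff, and_iff_right_iff_imp]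
    rintro rfl
    exact J.zero_mem
  simp only [single_one_dotProduct, hone, one_mul, hJ, Fintype.card_sum, Fintype.card_fin,
    ← two_mul] at hS
  have himage : lineBlock J a =
      (fun w => cls K e (a + w)) '' {d : Fin e ⊕ Fin e → K | (∀ i, d i ∈ J) ∧ d i = 0} := by
    ext B
    constructor
    · rintro ⟨b, hb, rfl, σ, hσ⟩
      obtain ⟨u, hu⟩ := hi
      obtain ⟨v, hv⟩ := isUnit_of_sub_mem hunit (σ.isUnit.mul ⟨u, hu⟩) (hσ i)
      refine ⟨(u * v⁻¹) • b - a, ⟨fun j => ?_, ?_⟩, ?_⟩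
      · have h1 := J.mul_mem_left (↑(u * v⁻¹) : K) (hσ j)
        have h2 := J.mul_mem_left (-(↑v⁻¹ : K) * a j) (hσ i)
        have h3 : (↑(u * v⁻¹) : K) * (b j - σ * a j) + -(↑v⁻¹ : K) * a j * (b i - σ * a i) =
            ((u * v⁻¹) • b - a) j := by
          simp only [Pi.sub_apply, Pi.smul_apply, Units.smul_def, smul_eq_mul, Units.val_mul]
          rw [← hv, ← hu]
          linear_combination (-a j) * v.inv_mul
        rw [← h3]
        exact J.add_mem h1 h2
      · simp [Units.smul_def, ← hu, ← hv]
      · simp only [add_sub_cancel]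
        exact cls_smul _ _
    · rintro ⟨w, ⟨hw, hwi⟩, rfl⟩
      exact ⟨a + w, ⟨i, by simpa [hwi] using hi⟩, rfl, 1, fun j => by simpa using hw j⟩
  rw [himage, Set.InjOn.ncard_image, hS]
  rintro w ⟨-, hw⟩ w' ⟨-, hw'⟩ h
  obtain ⟨σ, hσ⟩ := cls_eq_cls_iff.mp h
  have hσi := congrFun hσ i
  simp only [Pi.add_apply, hw, hw', add_zero, Pi.smul_apply, Units.smul_def, smul_eq_mul] at hσi
  have hσ1 : σ = 1 := Units.ext (hi.mul_right_cancel (by rw [← hσi, Units.val_one, one_mul]))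
  rw [hσ1, one_smul] at hσ
  exact (add_left_cancel hσ).symm

lemma ncard_commonNeighbors_mul (a b : Fin e ⊕ Fin e → K) :
    {C | C ∈ classes K e ∧ adjY K J e C (cls K e a) ∧ adjY K J e C (cls K e b)}.ncard *
        Nat.card Kˣ =
      {d : Fin e ⊕ Fin e → K | (∃ i, IsUnit (d i)) ∧ (a ⬝ᵥ d ∈ J ∧ a ⬝ᵥ d ≠ 0) ∧
        b ⬝ᵥ d ∈ J ∧ b ⬝ᵥ d ≠ 0}.ncard := by
  rw [ncard_classes_sep_mul, ← ncard_unitTuples_sep_twist]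
  simp only [adjY_cls_comm a, adjY_cls_comm b, adjY_cls_iff, sympForm_eq_dotProduct]

lemma ncard_neighbors_mul (a : Fin e ⊕ Fin e → K) :
    {C | C ∈ classes K e ∧ adjY K J e (cls K e a) C}.ncard * Nat.card Kˣ =
      {d : Fin e ⊕ Fin e → K | (∃ i, IsUnit (d i)) ∧ a ⬝ᵥ d ∈ J ∧ a ⬝ᵥ d ≠ 0}.ncard := by
  rw [ncard_classes_sep_mul, ← ncard_unitTuples_sep_twist]
  simp only [adjY_cls_iff, sympForm_eq_dotProduct]

end ProjectiveClasses

lemma ncard_eq_ncard_mul_of_existsUnique {α : Type} [Finite α] {X : Set α} {P : Set (Set α)}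
    {n : ℕ} (hsub : ∀ c ∈ P, c ⊆ X) (hcard : ∀ c ∈ P, c.ncard = n)
    (hpart : ∀ x ∈ X, ∃! c, c ∈ P ∧ x ∈ c) : X.ncard = P.ncard * n := by
  have := Fintype.ofFinite P
  let f : (Σ c : P, (c : Set α)) → X := fun y => ⟨y.2, hsub _ y.1.2 y.2.2⟩
  have hf : Function.Bijective f := by
    constructor
    · rintro ⟨⟨c, hc⟩, x, hx⟩ ⟨⟨c', hc'⟩, x', hx'⟩ h
      obtain rfl : x = x' := congrArg Subtype.val h
      obtain rfl : c = c' := (hpart x (hsub c hc hx)).unique ⟨hc, hx⟩ ⟨hc', hx'⟩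
      rfl
    · rintro ⟨x, hx⟩
      obtain ⟨c, ⟨hc, hxc⟩, -⟩ := hpart x hx
      exact ⟨⟨⟨c, hc⟩, x, hxc⟩, rfl⟩
  have h := Nat.card_eq_of_bijective f hf
  rw [Nat.card_sigma, Finset.sum_congr rfl fun c _ => hcard c.1 c.2, Finset.sum_const,
    smul_eq_mul, Finset.card_univ, ← Nat.card_eq_fintype_card] at h
  exact h.symm

/-- Theorem 2: `Y(2e,K)` is a divisible design graph with the stated parameters. -/
theorem Y_is_divisible_design_graph
    (K : Type) [CommRing K] [Fintype K]
    (J : Ideal K) (r : K) (q : ℕ)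
    (hJr : J = Ideal.span {r})
    (hJbot : J ≠ ⊥) (hJtop : J ≠ ⊤)
    (hideals : ∀ I : Ideal K, I = ⊥ ∨ I = J ∨ I = ⊤)
    (hq : IsPrimePow q)
    (hqcard : Nat.card (K ⧸ J) = q)
    (e : ℕ) (he : 2 ≤ e) :
    Nat.card (classes K e) = q ^ (2 * e - 1) * (q ^ (2 * e) - 1) / (q - 1) ∧
    (∀ A ∈ classes K e,
      Nat.card ↥{B ∈ classes K e | adjY K J e A B} =
        q ^ (4 * e - 3) - q ^ (2 * e - 2)) ∧
    ∃ P : Set (Set (Set (Fin e ⊕ Fin e → K))),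
      Nat.card P = (q ^ (2 * e) - 1) / (q - 1) ∧
      (∀ c ∈ P, c ⊆ classes K e ∧ Nat.card c = q ^ (2 * e - 1)) ∧
      (∀ A ∈ classes K e, ∃! c, c ∈ P ∧ A ∈ c) ∧
      (∀ c ∈ P, ∀ A ∈ c, ∀ B ∈ c, A ≠ B →
        Nat.card ↥{C ∈ classes K e | adjY K J e C A ∧ adjY K J e C B} =
          q ^ (4 * e - 3) - q ^ (4 * e - 4) - q ^ (2 * e - 2)) ∧
      (∀ c₁ ∈ P, ∀ c₂ ∈ P, c₁ ≠ c₂ → ∀ A ∈ c₁, ∀ B ∈ c₂,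
        Nat.card ↥{C ∈ classes K e | adjY K J e C A ∧ adjY K J e C B} =
          q ^ (4 * e - 4) - q ^ (4 * e - 5) - q ^ (2 * e - 2) + q ^ (2 * e - 3)) := by
  have : Finite K := inferInstance
  have hunit := mem_iff_not_isUnit hJtop hideals
  have hmul := mul_generator_eq_zero_iff hJr hJbot hunit (generator_mul_self hJr hJtop hideals)
  have hr : r ∈ J := hJr ▸ Ideal.mem_span_singleton_self r
  have hJ : Nat.card J = q := (card_ideal_eq_card_quotient hJr hmul).trans hqcard
  have hK : Nat.card K = q ^ 2 := by
    rw [Submodule.card_eq_card_quotient_mul_card J, hqcard, hJ, sq]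
  have hq1 := hq.one_lt
  obtain ⟨s, hs⟩ : ∃ s, q = s + 1 := ⟨q - 1, by omega⟩
  have hq0 : 0 < q := by omega
  have hs0 : 0 < s := by omega
  have hU : Nat.card Kˣ = q * s := by
    have := card_units_add_card_ideal hunit
    rw [hJ, hK] at this
    subst hs
    nlinarith
  have hqs : 0 < q * s := Nat.mul_pos hq0 hs0
  obtain ⟨M, hM⟩ : ∃ M, 2 * e = M + 4 := ⟨2 * e - 4, by omega⟩
  have hcard : Fintype.card (Fin e ⊕ Fin e) = M + 4 := by
    rw [Fintype.card_sum, Fintype.card_fin, ← two_mul, hM]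
  have hexp : 2 * e - 1 = M + 3 ∧ 4 * e - 3 = 2 * M + 5 ∧ 2 * e - 2 = M + 2 ∧
      4 * e - 4 = 2 * M + 4 ∧ 4 * e - 5 = 2 * M + 3 ∧ 2 * e - 3 = M + 1 := by omega
  obtain ⟨h1, h2, h3, h4, h5, h6⟩ := hexp
  rw [h1, h2, h3, h4, h5, h6, hM]
  have hqsub : q - 1 = s := by omega
  have hsucc : ∀ n, q ^ (n + 1) = q ^ n + s * q ^ n := fun n => by
    rw [pow_succ]
    nth_rewrite 2 [hs]
    ring
  have hclasses : (classes K e).ncard * s = q ^ (M + 3) * (q ^ (M + 4) - 1) := by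
    have h := ncard_classes_sep_mul (K := K) (e := e) (fun _ => True)
    have h' := ncard_unitTuples_add (ι := Fin e ⊕ Fin e) hunit hJ hK
    simp only [and_true] at h
    rw [hU] at h
    rw [hcard] at h'
    change (classes K e).ncard * (q * s) = {d : Fin e ⊕ Fin e → K | ∃ i, IsUnit (d i)}.ncard at h
    rw [← h] at h'
    refine Nat.eq_of_mul_eq_mul_right hq0 ?_
    rw [Nat.mul_sub, Nat.sub_mul, mul_one]
    refine Nat.eq_sub_of_add_eq ?_
    calc _ = (classes K e).ncard * (q * s) + q ^ (M + 4) := by ring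
      _ = q ^ (2 * (M + 4)) := h'
      _ = _ := by ring
  have hblock : ∀ a ∈ unitTuples K e, (lineBlock J a).ncard = q ^ (M + 3) := fun a ha => by
    have h := ncard_lineBlock hunit hJ ha
    rw [hM, pow_succ] at h
    exact Nat.eq_of_mul_eq_mul_right hq0 h
  have hpart : ∀ A ∈ classes K e,
      ∃! c, c ∈ {c | ∃ a ∈ unitTuples K e, c = lineBlock J a} ∧ A ∈ c := by
    rintro _ ⟨a, ha, rfl⟩
    refine ⟨lineBlock J a, ⟨⟨a, ha, rfl⟩, ?_⟩, ?_⟩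
    · rw [cls_mem_lineBlock_iff ha]
      simpa using sameLine_smul J 1 a
    · rintro _ ⟨⟨b, hb, rfl⟩, h⟩
      exact lineBlock_eq ((cls_mem_lineBlock_iff ha).mp h)
  have hle : q ^ (M + 2) ≤ s * q ^ (2 * M + 3) :=
    (Nat.pow_le_pow_right hq0 (by omega)).trans (Nat.le_mul_of_pos_left _ hs0)
  refine ⟨?_, ?_, {c | ∃ a ∈ unitTuples K e, c = lineBlock J a}, ?_, ?_, hpart, ?_, ?_⟩
  · rw [hqsub, ← hclasses, Nat.mul_div_cancel _ hs0]
    rfl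
  · rintro _ ⟨a, ha, rfl⟩
    have h := ncard_neighbors_mul (J := J) a
    have h' := ncard_unit_sep_dotProduct hunit hs hJ hK hcard ha
    rw [← h, hU, ← add_mul] at h'
    exact Nat.eq_sub_of_add_eq (Nat.eq_of_mul_eq_mul_right hqs h')
  · have hsum : (classes K e).ncard =
        {c | ∃ a ∈ unitTuples K e, c = lineBlock J a}.ncard * q ^ (M + 3) := by
      refine ncard_eq_ncard_mul_of_existsUnique ?_ ?_ hpart
      · rintro _ ⟨a, ha, rfl⟩ _ ⟨b, hb, rfl, -⟩
        exact ⟨b, hb, rfl⟩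
      · rintro _ ⟨a, ha, rfl⟩
        exact hblock a ha
    rw [hsum, mul_right_comm, mul_comm (q ^ (M + 3))] at hclasses
    have h := Nat.eq_of_mul_eq_mul_right (pow_pos hq0 _) hclasses
    rw [hqsub, ← h, Nat.mul_div_cancel _ hs0]
    rfl
  · rintro _ ⟨a, ha, rfl⟩
    refine ⟨?_, hblock a ha⟩
    rintro _ ⟨b, hb, rfl, -⟩
    exact ⟨b, hb, rfl⟩
  · rintro _ ⟨x, hx, rfl⟩ _ ⟨a, ha, rfl, hxa⟩ _ ⟨b, hb, rfl, hxb⟩ hne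
    obtain ⟨σ, hσ⟩ := (hxb.symm.trans hxa)
    have hdiv : ∀ i, ∃ t, t * r = a i - σ * b i := fun i => by
      have := hσ i
      rwa [hJr, Ideal.mem_span_singleton'] at this
    choose t ht using hdiv
    have hb' : σ • b = a + r • (-t) := by
      ext i
      simp only [Pi.add_apply, Pi.smul_apply, Units.smul_def, smul_eq_mul, Pi.neg_apply]
      linear_combination ht i
    rw [← cls_smul σ b, hb'] at hne ⊢
    have hminor : ∃ i j, IsUnit (a i * (-t) j - a j * (-t) i) := by
      refine exists_isUnit_minor hunit ha ?_
      rintro ⟨c, hc⟩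
      obtain ⟨v, hv⟩ := isUnit_of_sub_mem hunit (y := 1 + r * c) isUnit_one
        (by simpa using J.mul_mem_right c hr)
      refine hne (cls_eq_cls_iff.mpr ⟨v, ?_⟩)
      ext i
      have := (hmul _).mpr (hc i)
      simp only [Pi.add_apply, Pi.smul_apply, Units.smul_def, smul_eq_mul, hv]
      linear_combination this
    have h := ncard_commonNeighbors_mul (J := J) a (a + r • (-t))
    have h' := ncard_unit_sep_dotProduct_add_smul hunit hr hmul hs hJ hK hcard hminor ha
    rw [← h, hU, ← add_mul] at h'
    refine Nat.eq_sub_of_add_eq ((Nat.eq_of_mul_eq_mul_right hqs h').trans ?_)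
    have : q ^ (2 * M + 5) = _ := hsucc (2 * M + 4)
    omega
  · rintro _ ⟨x, hx, rfl⟩ _ ⟨y, hy, rfl⟩ hne _ ⟨a, ha, rfl, hxa⟩ _ ⟨b, hb, rfl, hyb⟩
    have hminor : ∃ i j, IsUnit (a i * b j - a j * b i) := by
      refine exists_isUnit_minor hunit ha ?_
      rintro ⟨c, hc⟩
      by_cases hcu : IsUnit c
      · obtain ⟨σ, rfl⟩ := hcu
        exact hne (lineBlock_eq ((hxa.trans ⟨σ, hc⟩).trans hyb.symm))
      · obtain ⟨i, hi⟩ := hb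
        have := J.add_mem (hc i) (J.mul_mem_right (a i) ((hunit c).mpr hcu))
        rw [sub_add_cancel] at this
        exact (hunit _).mp this hi
    have h := ncard_commonNeighbors_mul (J := J) a b
    have h' := ncard_unit_sep_dotProduct_dotProduct hunit hs hJ hK hcard hminor
    rw [← h, hU, ← add_mul] at h'
    have h'' := Nat.eq_of_mul_eq_mul_right hqs h'
    have e1 : q ^ (2 * M + 4) = _ := hsucc (2 * M + 3)
    have e2 : q ^ (M + 2) = _ := hsucc (M + 1)
    change Set.ncard _ = _
    generalize Set.ncard _ = X at h'' ⊢
    omega
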